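/- Let f be a holomorphic modular function for SL(2,ℤ), z_0 ∈ ℍ, and W_1, …, W_k non-empty even words. For 1 ≤ i ≤ k set u_i := [\overline{W_i W_{i+1} ⋯ W_k W_1 ⋯ W_{i−1}}] (the cyclic rotation starting at W_i, so u_1 = [\overline{W_1 ⋯ W_k}]). Then ∫_{z_0}^{γ_{W_1 ⋯ W_k} z_0} f η_{u_1} = Σ_{i=1}^k ∫_{z_0}^{γ_{W_i} z_0} f η_{u_i}. -/

import Mathlib

open Matrix Filter Topology

noncomputable section

/-- The matrix `[[k,1],[1,0]]` of a single partial quotient. -/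
def cfMat (k : ℕ+) : Matrix (Fin 2) (Fin 2) ℤ := !![(k : ℤ), 1; 1, 0]

/-- `γ_W` for a word `W = (k_1, …, k_r)` of positive integers. -/
def gammaWord (W : List ℕ+) : Matrix (Fin 2) (Fin 2) ℤ := (W.map cfMat).prod

/-- `W^n`, the `n`-fold concatenation of the word `W`. -/
def wordPow (W : List ℕ+) (n : ℕ) : List ℕ+ := (List.replicate n W).flatten

/-- `N(W)`: the largest `n` such that `W = V^n` for some word `V`. -/
def wordN (W : List ℕ+) : ℕ := sSup {n : ℕ | ∃ V : List ℕ+, W = wordPow V n}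

/-- Möbius action of an integer matrix on `ℝ`. -/
def actR (M : Matrix (Fin 2) (Fin 2) ℤ) (x : ℝ) : ℝ :=
  ((M 0 0 : ℝ) * x + (M 0 1 : ℝ)) / ((M 1 0 : ℝ) * x + (M 1 1 : ℝ))

/-- Möbius action of an integer matrix on `ℂ`. -/
def actC (M : Matrix (Fin 2) (Fin 2) ℤ) (z : ℂ) : ℂ :=
  ((M 0 0 : ℤ) * z + (M 0 1 : ℤ)) / ((M 1 0 : ℤ) * z + (M 1 1 : ℤ))

/-- Möbius action of a real matrix on `ℝ`. -/
def actRR (M : Matrix (Fin 2) (Fin 2) ℝ) (x : ℝ) : ℝ :=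
  (M 0 0 * x + M 0 1) / (M 1 0 * x + M 1 1)

/-- Möbius action of a real matrix on `ℂ`. -/
def actCR (M : Matrix (Fin 2) (Fin 2) ℝ) (z : ℂ) : ℂ :=
  ((M 0 0 : ℂ) * z + (M 0 1 : ℂ)) / ((M 1 0 : ℂ) * z + (M 1 1 : ℂ))

/-- Automorphy factor `j(M, x) = c·x + d`. -/
def jFac (M : Matrix (Fin 2) (Fin 2) ℝ) (x : ℝ) : ℝ := M 1 0 * x + M 1 1

/-- `w = [\overline{W}]`: `w` is the (unique) real number `> 1` fixed by the Möbius action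
of `γ_W`. -/
def IsCFValue (W : List ℕ+) (w : ℝ) : Prop := 1 < w ∧ actR (gammaWord W) w = w

/-- `w'` is the Galois conjugate of `[\overline{W}]`, i.e. the other real fixed point
of `γ_W`. -/
def IsCFConj (W : List ℕ+) (w w' : ℝ) : Prop := w' ≠ w ∧ actR (gammaWord W) w' = w'

/-- `g = γ_w` is the fundamental automorph of `w`: it fixes `w`, has `ε_w = j(g,w) > 1`, and
the stabilizer of `w` in `SL(2,ℤ)` is exactly `{± g^n : n ∈ ℤ}`. -/
def IsFundAutomorph (w : ℝ) (g : Matrix.SpecialLinearGroup (Fin 2) ℤ) : Prop :=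
  actR (g : Matrix (Fin 2) (Fin 2) ℤ) w = w ∧
  1 < (g 1 0 : ℝ) * w + (g 1 1 : ℝ) ∧
  ∀ M : Matrix.SpecialLinearGroup (Fin 2) ℤ,
    actR (M : Matrix (Fin 2) (Fin 2) ℤ) w = w ↔
      ∃ n : ℤ,
        (M : Matrix (Fin 2) (Fin 2) ℤ) =
          ((g ^ n : Matrix.SpecialLinearGroup (Fin 2) ℤ) : Matrix (Fin 2) (Fin 2) ℤ) ∨
        (M : Matrix (Fin 2) (Fin 2) ℤ) =
          -((g ^ n : Matrix.SpecialLinearGroup (Fin 2) ℤ) : Matrix (Fin 2) (Fin 2) ℤ)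

/-- Contour integral of `g` along the straight line segment from `a` to `b`. -/
def segInt (g : ℂ → ℂ) (a b : ℂ) : ℂ := (b - a) * ∫ t in (0:ℝ)..1, g (a + t * (b - a))

/-- The integrand of the differential `η_{w', w}`. -/
def eta (w w' : ℝ) (z : ℂ) : ℂ := 1 / (z - (w' : ℂ)) - 1 / (z - (w : ℂ))

/-- `∫_{z₀}^{z₁} f η_w`: the contour integral of `f(z)·(1/(z-w') - 1/(z-w)) dz`
along the straight line segment from `z₀` to `z₁`. -/
def cycInt (f : ℂ → ℂ) (w w' : ℝ) (z0 z1 : ℂ) : ℂ := segInt (fun z => f z * eta w w' z) z0 z1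

/-- A holomorphic modular function for `SL(2,ℤ)`: holomorphic on the upper half plane and
invariant under the Möbius action of `SL(2,ℤ)`. -/
def IsModular (f : ℂ → ℂ) : Prop :=
  DifferentiableOn ℂ f {z : ℂ | 0 < z.im} ∧
  ∀ g : Matrix.SpecialLinearGroup (Fin 2) ℤ, ∀ z : ℂ, 0 < z.im →
    f (actC (g : Matrix (Fin 2) (Fin 2) ℤ) z) = f z

/-- `w` is a real quadratic irrational with Galois conjugate `w'` (the other root of the
same integral quadratic equation). -/
def IsQuadPair (w w' : ℝ) : Prop :=
  Irrational w ∧ w' ≠ w ∧ ∃ a b c : ℤ, a ≠ 0 ∧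
    (a : ℝ) * w ^ 2 + (b : ℝ) * w + (c : ℝ) = 0 ∧
    (a : ℝ) * w' ^ 2 + (b : ℝ) * w' + (c : ℝ) = 0

/-- The `i`-th term (0-indexed) of the regular continued fraction expansion of `x`:
term `0` is `⌊x⌋` and term `i+1` is the `i`-th partial denominator. -/
def cfTerm (x : ℝ) (i : ℕ) : Option ℝ :=
  match i with
  | 0 => some (GenContFract.of x).h
  | i + 1 => (GenContFract.of x).partDens.get? i

/-- `w` is a real quadratic irrational. -/
def IsQuadIrr (w : ℝ) : Prop :=
  Irrational w ∧ ∃ a b c : ℤ, a ≠ 0 ∧ (a : ℝ) * w ^ 2 + (b : ℝ) * w + (c : ℝ) = 0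

abbrev SL2Z := Matrix.SpecialLinearGroup (Fin 2) ℤ
abbrev SL2R := Matrix.SpecialLinearGroup (Fin 2) ℝ

theorem gammaWord_append (A B : List ℕ+) : gammaWord (A ++ B) = gammaWord A * gammaWord B := by
  simp [gammaWord]

theorem gammaWord_cons (k : ℕ+) (A : List ℕ+) : gammaWord (k :: A) = cfMat k * gammaWord A := by
  simp [gammaWord]

theorem det_gammaWord (A : List ℕ+) : (gammaWord A).det = (-1) ^ A.length := by
  induction A with
  | nil => simp [gammaWord]
  | cons k A ih =>
    rw [gammaWord_cons, det_mul, ih, List.length_cons, pow_succ']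
    simp [cfMat, det_fin_two]

theorem gammaWord_cons_entries (k : ℕ+) (A : List ℕ+) :
    gammaWord (k :: A) 0 0 = k * gammaWord A 0 0 + gammaWord A 1 0 ∧
    gammaWord (k :: A) 0 1 = k * gammaWord A 0 1 + gammaWord A 1 1 ∧
    gammaWord (k :: A) 1 0 = gammaWord A 0 0 ∧
    gammaWord (k :: A) 1 1 = gammaWord A 0 1 := by
  simp [gammaWord_cons, cfMat, mul_apply, Fin.sum_univ_two]

theorem gammaWord_nonneg (A : List ℕ+) :
    1 ≤ gammaWord A 0 0 ∧ 0 ≤ gammaWord A 0 1 ∧ 0 ≤ gammaWord A 1 0 ∧ 0 ≤ gammaWord A 1 1 ∧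
      1 ≤ gammaWord A 0 1 + gammaWord A 1 1 := by
  induction A with
  | nil => simp [gammaWord]
  | cons k A ih =>
    obtain ⟨h1, h2, h3, h4⟩ := gammaWord_cons_entries k A
    obtain ⟨ha, hb, hc, hd, hbd⟩ := ih
    have hk : (1 : ℤ) ≤ k := by exact_mod_cast (one_le : 1 ≤ k)
    rw [h1, h2, h3, h4]
    refine ⟨?_, ?_, ?_, ?_, ?_⟩ <;> nlinarith

/-- The lower-left, upper-right and lower-right entries of `γ_A` are positive when `A` is
a non-empty even word. -/
theorem gammaWord_pos {A : List ℕ+} (hA : A ≠ []) (he : Even A.length) :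
    0 < gammaWord A 0 1 ∧ 0 < gammaWord A 1 0 ∧ 0 < gammaWord A 1 1 := by
  match A, hA, he with
  | [k], _, he => simp at he
  | k :: l :: B, _, _ =>
    obtain ⟨-, h2, h3, h4⟩ := gammaWord_cons_entries k (l :: B)
    obtain ⟨-, g2, -, -⟩ := gammaWord_cons_entries l B
    obtain ⟨ha, hb, hc, hd, hbd⟩ := gammaWord_nonneg (l :: B)
    obtain ⟨-, hb', -, hd', hbd'⟩ := gammaWord_nonneg B
    have hk : (1 : ℤ) ≤ k := by exact_mod_cast (one_le : 1 ≤ k)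
    have hl : (1 : ℤ) ≤ l := by exact_mod_cast (one_le : 1 ≤ l)
    rw [h2, h3, h4]
    refine ⟨?_, ?_, ?_⟩ <;> nlinarith

theorem im_pos_denom_ne_zero {M : Matrix (Fin 2) (Fin 2) ℤ} (hM : M.det = 1) {z : ℂ}
    (hz : 0 < z.im) : (M 1 0 : ℂ) * z + M 1 1 ≠ 0 := by
  intro h
  have him := congrArg Complex.im h
  have hre := congrArg Complex.re h
  simp only [Complex.add_im, Complex.mul_im, Complex.intCast_re, Complex.intCast_im, zero_mul,
    add_zero, Complex.zero_im, mul_eq_zero, hz.ne', or_false, Int.cast_eq_zero] at him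
  simp only [Complex.intCast_re, zero_mul, him, Int.cast_zero, zero_add,
    Complex.zero_re, Int.cast_eq_zero] at hre
  simp [det_fin_two, him, hre] at hM

theorem actC_im {M : Matrix (Fin 2) (Fin 2) ℤ} (hM : M.det = 1) (z : ℂ) :
    (actC M z).im = z.im / Complex.normSq ((M 1 0 : ℂ) * z + M 1 1) := by
  have h : (M 0 0 * M 1 1 - M 0 1 * M 1 0 : ℝ) = 1 := by
    rw [det_fin_two] at hM
    exact_mod_cast hM
  rw [actC, Complex.div_im, ← sub_div]
  congr 1
  simp
  linear_combination z.im * h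

theorem actC_im_pos {M : Matrix (Fin 2) (Fin 2) ℤ} (hM : M.det = 1) {z : ℂ} (hz : 0 < z.im) :
    0 < (actC M z).im := by
  rw [actC_im hM]
  exact div_pos hz (Complex.normSq_pos.2 (im_pos_denom_ne_zero hM hz))

theorem actC_mul {M N : Matrix (Fin 2) (Fin 2) ℤ} (hM : M.det = 1) (hN : N.det = 1) {z : ℂ}
    (hz : 0 < z.im) : actC (M * N) z = actC M (actC N z) := by
  have h1 := im_pos_denom_ne_zero hN hz
  have h2 := im_pos_denom_ne_zero hM (actC_im_pos hN hz)
  have h3 := im_pos_denom_ne_zero (M := M * N) (by rw [det_mul, hM, hN, one_mul]) hz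
  rw [actC, actC]
  rw [div_eq_div_iff h3 h2, actC]
  simp only [mul_apply, Fin.sum_univ_two]
  push_cast
  field_simp
  ring

theorem hasDerivAt_actC {M : Matrix (Fin 2) (Fin 2) ℤ} (hM : M.det = 1) {z : ℂ}
    (hz : 0 < z.im) : HasDerivAt (actC M) (1 / ((M 1 0 : ℂ) * z + M 1 1) ^ 2) z := by
  have h : (M 0 0 * M 1 1 - M 0 1 * M 1 0 : ℂ) = 1 := by
    rw [det_fin_two] at hM
    exact_mod_cast hM
  have hn : HasDerivAt (fun z : ℂ => (M 0 0 : ℂ) * z + M 0 1) (M 0 0 : ℂ) z := by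
    simpa using ((hasDerivAt_id z).const_mul (M 0 0 : ℂ)).add_const (M 0 1 : ℂ)
  have hd : HasDerivAt (fun z : ℂ => (M 1 0 : ℂ) * z + M 1 1) (M 1 0 : ℂ) z := by
    simpa using ((hasDerivAt_id z).const_mul (M 1 0 : ℂ)).add_const (M 1 1 : ℂ)
  refine (hn.div hd (im_pos_denom_ne_zero hM hz)).congr_deriv ?_
  congr 1
  linear_combination h

theorem sub_ofReal_ne_zero {z : ℂ} (hz : 0 < z.im) (v : ℝ) : z - v ≠ 0 := by
  intro h
  have := congrArg Complex.im h
  simp at this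
  exact hz.ne' this

theorem one_div_actC_sub_actR {M : Matrix (Fin 2) (Fin 2) ℤ} (hM : M.det = 1) {z : ℂ}
    (hz : 0 < z.im) {v : ℝ} (hv : (M 1 0 : ℝ) * v + M 1 1 ≠ 0) :
    1 / (actC M z - (actR M v : ℝ)) * (1 / ((M 1 0 : ℂ) * z + M 1 1) ^ 2) =
      1 / (z - v) - M 1 0 / ((M 1 0 : ℂ) * z + M 1 1) := by
  have h : (M 0 0 * M 1 1 - M 0 1 * M 1 0 : ℂ) = 1 := by
    rw [det_fin_two] at hM
    exact_mod_cast hM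
  have h1 := im_pos_denom_ne_zero hM hz
  have h2 : (M 1 0 : ℂ) * v + M 1 1 ≠ 0 := by exact_mod_cast hv
  have h3 := sub_ofReal_ne_zero hz v
  have h4 : actC M z - (actR M v : ℝ) =
      (z - v) / (((M 1 0 : ℂ) * z + M 1 1) * ((M 1 0 : ℂ) * v + M 1 1)) := by
    rw [actC, actR]
    push_cast
    rw [div_sub_div _ _ h1 h2]
    congr 1
    linear_combination (z - v) * h
  have h5 : (M 1 0 : ℂ) * v + M 1 1 = (M 1 0 : ℂ) * z + M 1 1 - M 1 0 * (z - v) := by ring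
  rw [h4, h5]
  generalize (M 1 0 : ℂ) * z + M 1 1 = D at h1 ⊢
  generalize z - v = t at h3 ⊢
  field_simp

/-- `η` pulled back along a Möbius map. -/
theorem eta_actC {M : Matrix (Fin 2) (Fin 2) ℤ} (hM : M.det = 1) {z : ℂ}
    (hz : 0 < z.im) {v v' : ℝ} (hv : (M 1 0 : ℝ) * v + M 1 1 ≠ 0)
    (hv' : (M 1 0 : ℝ) * v' + M 1 1 ≠ 0) :
    eta (actR M v) (actR M v') (actC M z) * (1 / ((M 1 0 : ℂ) * z + M 1 1) ^ 2) =
      eta v v' z := by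
  rw [eta, sub_mul, one_div_actC_sub_actR hM hz hv, one_div_actC_sub_actR hM hz hv', eta]
  ring

theorem differentiableOn_eta (w w' : ℝ) : DifferentiableOn ℂ (eta w w') {z : ℂ | 0 < z.im} := by
  intro z hz
  have hd (v : ℝ) : DifferentiableAt ℂ (fun z : ℂ => 1 / (z - v)) z :=
    (differentiableAt_const _).div (differentiableAt_id.sub_const _) (sub_ofReal_ne_zero hz v)
  exact ((hd w').sub (hd w)).differentiableWithinAt

theorem isOpen_im_pos : IsOpen {z : ℂ | 0 < z.im} :=
  isOpen_lt continuous_const Complex.continuous_im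

/-- Holomorphic functions on the upper half plane have primitives. -/
theorem exists_primitive_im_pos {g : ℂ → ℂ} (hg : DifferentiableOn ℂ g {z : ℂ | 0 < z.im}) :
    ∃ F : ℂ → ℂ, ∀ z : ℂ, 0 < z.im → HasDerivAt F (g z) z := by
  have hconv : Convex ℝ {z : ℂ | 0 < z.im} := convex_halfSpace_im_gt 0
  obtain ⟨F, hF⟩ := hconv.exists_forall_hasDerivWithinAt hg
  exact ⟨F, fun z hz => (hF z hz).hasDerivAt (isOpen_im_pos.mem_nhds hz)⟩

theorem segInt_eq_sub {F g : ℂ → ℂ} (hF : ∀ z : ℂ, 0 < z.im → HasDerivAt F (g z) z)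
    (hg : ContinuousOn g {z : ℂ | 0 < z.im}) {a b : ℂ} (ha : 0 < a.im) (hb : 0 < b.im) :
    segInt g a b = F b - F a := by
  have him : ∀ t ∈ Set.uIcc (0 : ℝ) 1, 0 < (a + t * (b - a)).im := by
    intro t ht
    rw [Set.uIcc_of_le zero_le_one] at ht
    have : (a + t * (b - a)).im = (1 - t) * a.im + t * b.im := by
      simp
      ring
    rw [this]
    rcases eq_or_lt_of_le ht.1 with h | h
    · simpa [← h] using ha
    · exact add_pos_of_nonneg_of_pos (mul_nonneg (sub_nonneg.2 ht.2) ha.le) (mul_pos h hb)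
  have hder : ∀ t ∈ Set.uIcc (0 : ℝ) 1,
      HasDerivAt (fun t : ℝ => F (a + t * (b - a))) ((b - a) * g (a + t * (b - a))) t := by
    intro t ht
    have hl : HasDerivAt (fun t : ℝ => a + (t : ℂ) * (b - a)) (b - a) t := by
      simpa using ((Complex.ofRealCLM.hasDerivAt (x := t)).mul_const (b - a)).const_add a
    rw [mul_comm]
    exact (hF _ (him t ht)).comp t hl
  have hcont : ContinuousOn (fun t : ℝ => (b - a) * g (a + t * (b - a))) (Set.uIcc (0 : ℝ) 1) :=
    continuousOn_const.mul (hg.comp (by fun_prop) him)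
  rw [segInt, ← intervalIntegral.integral_const_mul,
    intervalIntegral.integral_eq_sub_of_hasDerivAt hder hcont.intervalIntegrable]
  simp

/-- A Möbius fixed point in coordinates. -/
theorem quadratic_of_actR_eq {M : Matrix (Fin 2) (Fin 2) ℤ} (hd : M 1 1 ≠ 0) {x : ℝ}
    (hx : actR M x = x) :
    (M 1 0 : ℝ) * x ^ 2 + (M 1 1 - M 0 0) * x - M 0 1 = 0 := by
  have hne : (M 1 0 : ℝ) * x + M 1 1 ≠ 0 := by
    intro h
    have hx0 : x = 0 := by rw [← hx, actR, h, div_zero]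
    rw [hx0, mul_zero, zero_add] at h
    exact hd (by exact_mod_cast h)
  rw [actR, div_eq_iff hne] at hx
  linear_combination -hx

/-- If `P` intertwines `N` and `M` then it carries the fixed points of `N` to those of `M`. -/
theorem actR_quadratic_of_intertwine {M N P : Matrix (Fin 2) (Fin 2) ℤ} (hP : P.det = 1)
    (h : M * P = P * N) (hc : M 1 0 ≠ 0) {x : ℝ}
    (hx : (N 1 0 : ℝ) * x ^ 2 + (N 1 1 - N 0 0) * x - N 0 1 = 0) :
    (P 1 0 : ℝ) * x + P 1 1 ≠ 0 ∧
      (M 1 0 : ℝ) * actR P x ^ 2 + (M 1 1 - M 0 0) * actR P x - M 0 1 = 0 := by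
  have e (i j : Fin 2) := congrArg (Int.cast (R := ℝ)) (congrFun (congrFun h i) j)
  simp only [mul_apply, Fin.sum_univ_two] at e
  have e00 := e 0 0
  have e01 := e 0 1
  have e10 := e 1 0
  have e11 := e 1 1
  push_cast at e00 e01 e10 e11
  have hdet : (P 0 0 * P 1 1 - P 0 1 * P 1 0 : ℝ) = 1 := by
    rw [det_fin_two] at hP
    exact_mod_cast hP
  have key : (M 1 0 : ℝ) * (P 0 0 * x + P 0 1) ^ 2 +
      (M 1 1 - M 0 0) * (P 0 0 * x + P 0 1) * (P 1 0 * x + P 1 1)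
      - M 0 1 * (P 1 0 * x + P 1 1) ^ 2 = 0 := by
    have en : (M 0 0 : ℝ) * (P 0 0 * x + P 0 1) + M 0 1 * (P 1 0 * x + P 1 1) =
        P 0 0 * (N 0 0 * x + N 0 1) + P 0 1 * (N 1 0 * x + N 1 1) := by
      linear_combination x * e00 + e01
    have ed : (M 1 0 : ℝ) * (P 0 0 * x + P 0 1) + M 1 1 * (P 1 0 * x + P 1 1) =
        P 1 0 * (N 0 0 * x + N 0 1) + P 1 1 * (N 1 0 * x + N 1 1) := by
      linear_combination x * e10 + e11
    linear_combination (P 0 0 * x + P 0 1) * ed - (P 1 0 * x + P 1 1) * en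
      + (P 0 0 * P 1 1 - P 0 1 * P 1 0) * hx
  have hne : (P 1 0 : ℝ) * x + P 1 1 ≠ 0 := by
    intro h0
    rw [h0] at key
    have hc' : (M 1 0 : ℝ) ≠ 0 := by exact_mod_cast hc
    have hn : (P 0 0 : ℝ) * x + P 0 1 = 0 := by simpa [hc'] using key
    have : (1 : ℝ) = 0 := by
      linear_combination -hdet + P 0 0 * h0 - P 1 0 * hn
    exact one_ne_zero this
  refine ⟨hne, ?_⟩
  rw [actR]
  generalize (P 1 0 : ℝ) * x + P 1 1 = D at hne key ⊢
  generalize (P 0 0 : ℝ) * x + P 0 1 = n at key ⊢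
  field_simp
  linear_combination key

theorem eq_of_quadratic_nonneg {b c e x y : ℝ} (hb : 0 < b) (hc : 0 < c) (hx : 0 ≤ x)
    (hy : 0 ≤ y) (h1 : c * x ^ 2 + e * x - b = 0) (h2 : c * y ^ 2 + e * y - b = 0) : x = y := by
  by_contra hne
  have : c * (x * y) + b = 0 := by
    refine (mul_eq_zero.1 (?_ : (x - y) * (c * (x * y) + b) = 0)).resolve_left (sub_ne_zero.2 hne)
    linear_combination y * h1 - x * h2
  have := mul_nonneg hc.le (mul_nonneg hx hy)
  linarith

theorem eq_of_quadratic_ne {b c e x y z : ℝ} (hc : c ≠ 0) (hxy : y ≠ x) (hxz : z ≠ x)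
    (h1 : c * x ^ 2 + e * x - b = 0) (h2 : c * y ^ 2 + e * y - b = 0)
    (h3 : c * z ^ 2 + e * z - b = 0) : y = z := by
  have e1 : c * (y + x) + e = 0 := by
    refine (mul_eq_zero.1 (?_ : (y - x) * (c * (y + x) + e) = 0)).resolve_left (sub_ne_zero.2 hxy)
    linear_combination h2 - h1
  have e2 : c * (z + x) + e = 0 := by
    refine (mul_eq_zero.1 (?_ : (z - x) * (c * (z + x) + e) = 0)).resolve_left (sub_ne_zero.2 hxz)
    linear_combination h3 - h1
  exact mul_left_cancel₀ hc (by linear_combination e1 - e2)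

theorem actR_ne_of_ne {P : Matrix (Fin 2) (Fin 2) ℤ} (hP : P.det = 1) {x y : ℝ} (hxy : y ≠ x)
    (hx : (P 1 0 : ℝ) * x + P 1 1 ≠ 0) (hy : (P 1 0 : ℝ) * y + P 1 1 ≠ 0) :
    actR P y ≠ actR P x := by
  have hdet : (P 0 0 * P 1 1 - P 0 1 * P 1 0 : ℝ) = 1 := by
    rw [det_fin_two] at hP
    exact_mod_cast hP
  rw [actR, actR, Ne, div_eq_div_iff hy hx]
  intro h
  exact hxy (by linear_combination h - (y - x) * hdet)

/-- `γ_A` carries `[\overline{BA}]` and its conjugate to `[\overline{AB}]` and its conjugate. -/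
theorem actR_gammaWord_rotate {A B : List ℕ+} (hA : Even A.length) (hB : Even B.length)
    (hAB : A ++ B ≠ []) {w w' v v' : ℝ} (hw : IsCFValue (A ++ B) w)
    (hw' : IsCFConj (A ++ B) w w') (hv : IsCFValue (B ++ A) v) (hv' : IsCFConj (B ++ A) v v') :
    ((gammaWord A 1 0 : ℝ) * v + gammaWord A 1 1 ≠ 0 ∧ actR (gammaWord A) v = w) ∧
      (gammaWord A 1 0 : ℝ) * v' + gammaWord A 1 1 ≠ 0 ∧ actR (gammaWord A) v' = w' := by
  have hdet : (gammaWord A).det = 1 := by rw [det_gammaWord, hA.neg_one_pow]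
  obtain ⟨hb, hc, hd⟩ := gammaWord_pos hAB (by simpa using hA.add hB)
  obtain ⟨-, -, hd'⟩ := gammaWord_pos (A := B ++ A) (by simpa [and_comm] using hAB)
    (by simpa using hB.add hA)
  have hcomm : gammaWord (A ++ B) * gammaWord A = gammaWord A * gammaWord (B ++ A) := by
    simp only [gammaWord_append, Matrix.mul_assoc]
  obtain ⟨n1, q1⟩ := actR_quadratic_of_intertwine hdet hcomm hc.ne'
    (quadratic_of_actR_eq hd'.ne' hv.2)
  obtain ⟨n2, q2⟩ := actR_quadratic_of_intertwine hdet hcomm hc.ne'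
    (quadratic_of_actR_eq hd'.ne' hv'.2)
  have qw := quadratic_of_actR_eq hd.ne' hw.2
  have qw' := quadratic_of_actR_eq hd.ne' hw'.2
  have hbR : (0 : ℝ) < gammaWord (A ++ B) 0 1 := by exact_mod_cast hb
  have hcR : (0 : ℝ) < gammaWord (A ++ B) 1 0 := by exact_mod_cast hc
  have hnonneg : 0 ≤ actR (gammaWord A) v := by
    obtain ⟨h1, h2, h3, h4, -⟩ := gammaWord_nonneg A
    have h1' : (0 : ℝ) ≤ gammaWord A 0 0 := by exact_mod_cast zero_le_one.trans h1
    have h2' : (0 : ℝ) ≤ gammaWord A 0 1 := by exact_mod_cast h2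
    have h3' : (0 : ℝ) ≤ gammaWord A 1 0 := by exact_mod_cast h3
    have h4' : (0 : ℝ) ≤ gammaWord A 1 1 := by exact_mod_cast h4
    have hv0 : 0 ≤ v := zero_le_one.trans hv.1.le
    rw [actR]
    positivity
  have hvw : actR (gammaWord A) v = w :=
    eq_of_quadratic_nonneg hbR hcR hnonneg (zero_le_one.trans hw.1.le) q1 qw
  refine ⟨⟨n1, hvw⟩, n2, eq_of_quadratic_ne hcR.ne' ?_ hw'.1 qw q2 qw'⟩
  rw [← hvw]
  exact actR_ne_of_ne hdet hv'.1 n1 n2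

theorem even_length_flatten {L : List (List ℕ+)} (h : ∀ A ∈ L, Even A.length) :
    Even L.flatten.length := by
  induction L with
  | nil => simp
  | cons A L ih =>
    rw [List.flatten_cons, List.length_append]
    exact (h A (by simp)).add (ih fun B hB => h B (by simp [hB]))

/-- Splitting a cycle integral along a decomposition `W₁ ⋯ W_k`:
`∫_{z₀}^{γ_{W₁⋯W_k} z₀} f η_{u₁} = Σᵢ ∫_{z₀}^{γ_{Wᵢ} z₀} f η_{uᵢ}`, where `uᵢ` is the value of
the cyclic rotation of the word starting at `Wᵢ`. -/
theorem cycInt_splitting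
    (f : ℂ → ℂ) (hf : IsModular f) (z0 : ℂ) (hz0 : 0 < z0.im)
    (k : ℕ) (hk : 1 ≤ k)
    (W : Fin k → List ℕ+) (hWne : ∀ i, W i ≠ []) (hWe : ∀ i, Even (W i).length)
    (u u' : Fin k → ℝ)
    (hu : ∀ i : Fin k, IsCFValue ((List.ofFn W).rotate (i : ℕ)).flatten (u i))
    (hu' : ∀ i : Fin k, IsCFConj ((List.ofFn W).rotate (i : ℕ)).flatten (u i) (u' i)) :
    cycInt f (u ⟨0, hk⟩) (u' ⟨0, hk⟩) z0 (actC (gammaWord (List.ofFn W).flatten) z0) =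
      ∑ i : Fin k, cycInt f (u i) (u' i) z0 (actC (gammaWord (W i)) z0) := by
  have hLe : ∀ A ∈ List.ofFn W, Even A.length := by
    intro A hA
    obtain ⟨i, rfl⟩ := List.mem_ofFn.1 hA
    exact hWe i
  have hLne : (List.ofFn W).flatten ≠ [] := fun h =>
    hWne ⟨0, hk⟩ (List.flatten_eq_nil_iff.1 h _ (List.mem_ofFn.2 ⟨_, rfl⟩))
  have htake (n : ℕ) : Even ((List.ofFn W).take n).flatten.length :=
    even_length_flatten fun A hA => hLe A (List.mem_of_mem_take hA)
  have hdrop (n : ℕ) : Even ((List.ofFn W).drop n).flatten.length :=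
    even_length_flatten fun A hA => hLe A (List.mem_of_mem_drop hA)
  set P : ℕ → Matrix (Fin 2) (Fin 2) ℤ := fun n =>
    gammaWord ((List.ofFn W).take n).flatten with hPdef
  have hP (n : ℕ) : (P n).det = 1 := by rw [hPdef, det_gammaWord, (htake n).neg_one_pow]
  have hcont (w w' : ℝ) : DifferentiableOn ℂ (fun z => f z * eta w w' z) {z : ℂ | 0 < z.im} :=
    hf.1.mul (differentiableOn_eta w w')
  obtain ⟨F, hF⟩ := exists_primitive_im_pos (hcont (u ⟨0, hk⟩) (u' ⟨0, hk⟩))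
  have hterm (i : Fin k) : cycInt f (u i) (u' i) z0 (actC (gammaWord (W i)) z0) =
      F (actC (P (i + 1)) z0) - F (actC (P i) z0) := by
    have hW : (gammaWord (W i)).det = 1 := by rw [det_gammaWord, (hWe i).neg_one_pow]
    have hsplit : (List.ofFn W).flatten =
        ((List.ofFn W).take i).flatten ++ ((List.ofFn W).drop i).flatten := by
      rw [← List.flatten_append, List.take_append_drop]
    have hrot : ((List.ofFn W).rotate i).flatten =
        ((List.ofFn W).drop i).flatten ++ ((List.ofFn W).take i).flatten := by
      rw [List.rotate_eq_drop_append_take (by simp [i.2.le]), List.flatten_append]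
    have hw := hu ⟨0, hk⟩
    have hw' := hu' ⟨0, hk⟩
    have hv := hu i
    have hv' := hu' i
    rw [List.rotate_zero, hsplit] at hw hw'
    rw [hrot] at hv hv'
    obtain ⟨⟨n1, e1⟩, n2, e2⟩ :=
      actR_gammaWord_rotate (htake i) (hdrop i) (hsplit ▸ hLne) hw hw' hv hv'
    have hPs : P (i + 1) = P i * gammaWord (W i) := by
      have : (List.ofFn W).take (i + 1) = (List.ofFn W).take i ++ [W i] := by
        rw [List.take_succ_eq_append_getElem (by simp)]
        simp
      simp only [hPdef]
      rw [this, List.flatten_append, gammaWord_append]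
      simp
    rw [hPs, actC_mul (hP i) hW hz0]
    refine segInt_eq_sub (F := fun z => F (actC (P i) z)) (fun z hz => ?_)
      (hcont _ _).continuousOn hz0 (actC_im_pos hW hz0)
    have hcomp := (hF _ (actC_im_pos (hP i) hz)).comp z (hasDerivAt_actC (hP i) hz)
    rw [mul_assoc, ← e1, ← e2, eta_actC (hP i) hz n1 n2] at hcomp
    rwa [hf.2 ⟨P i, hP i⟩ z hz] at hcomp
  have hPk : P k = gammaWord (List.ofFn W).flatten := by
    simp only [hPdef]
    rw [List.take_of_length_le (by simp)]
  have hP0 : actC (P 0) z0 = z0 := by simp [hPdef, gammaWord, actC]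
  rw [Finset.sum_congr rfl fun i _ => hterm i,
    Fin.sum_univ_eq_sum_range (fun n => F (actC (P (n + 1)) z0) - F (actC (P n) z0)) k,
    Finset.sum_range_sub (fun n => F (actC (P n) z0)), hP0, ← hPk]
  exact segInt_eq_sub hF (hcont _ _).continuousOn hz0 (actC_im_pos (hP k) hz0)
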